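/- There exists no finite simple graph on a nonempty vertex set that is 5-regular and in which the subgraph induced by the open neighbourhood of every vertex has exactly 7 edges; that is, no (5,7)-constant graph exists. -/

import Mathlib

/-- The number of edges of the subgraph of `G` induced by the open
neighbourhood of the vertex `v` (the quantity `e(v)`). -/
noncomputable def nbhdEdgeCount {V : Type*} (G : SimpleGraph V) (v : V) : ℕ :=
  Nat.card (SimpleGraph.induce (G.neighborSet v) G).edgeSet

namespace SimpleGraph

variable {V : Type*} [Fintype V] [DecidableEq V] (G : SimpleGraph V) [DecidableRel G.Adj]

/-- The number of common neighbours of two vertices. -/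
def codegree (u v : V) : ℕ := (G.neighborFinset u ∩ G.neighborFinset v).card

lemma codegree_comm (u v : V) : G.codegree u v = G.codegree v u := by
  rw [codegree, codegree, Finset.inter_comm]

lemma sum_codegree_eq_two_mul_nbhdEdgeCount (v : V) :
    ∑ u ∈ G.neighborFinset v, G.codegree v u = 2 * nbhdEdgeCount G v := by
  classical
  have key := (induce (G.neighborSet v) G).sum_degrees_eq_twice_card_edges
  rw [nbhdEdgeCount, Nat.card_eq_fintype_card, ← edgeFinset_card, ← key]
  rw [← Finset.sum_coe_sort]
  refine Fintype.sum_equiv (Equiv.subtypeEquivRight fun x => by simp) _ _ fun u => ?_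
  rw [codegree, ← card_neighborFinset_eq_degree]
  symm
  refine Finset.card_bij (fun x _ => x.1) ?_ ?_ ?_
  · rintro ⟨x, hx⟩ h
    have hux : G.Adj u x := by simpa using h
    exact Finset.mem_inter.2 ⟨by simpa using hx, by simpa using hux⟩
  · intro x _ y _ h
    exact Subtype.ext h
  · intro x hx
    simp only [Finset.mem_inter, mem_neighborFinset] at hx
    exact ⟨⟨x, hx.1⟩, by simpa using hx.2, rfl⟩

variable {G} {u v w : V}

lemma inter_neighborFinset_subset_erase :
    G.neighborFinset v ∩ G.neighborFinset w ⊆ (G.neighborFinset v).erase w := by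
  intro x hx
  simp only [Finset.mem_inter, mem_neighborFinset, Finset.mem_erase] at hx ⊢
  exact ⟨hx.2.ne', hx.1⟩

lemma Adj.card_erase_neighborFinset (hG : G.IsRegularOfDegree 5) (h : G.Adj v w) :
    ((G.neighborFinset v).erase w).card = 4 := by
  rw [Finset.card_erase_of_mem (by simpa using h), card_neighborFinset_eq_degree, hG v]

lemma Adj.codegree_add_sum_erase (h : G.Adj v w) :
    G.codegree v w + ∑ x ∈ (G.neighborFinset v).erase w, G.codegree v x =
      ∑ x ∈ G.neighborFinset v, G.codegree v x :=
  Finset.add_sum_erase _ (fun x => G.codegree v x) (by simpa using h)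

lemma Adj.codegree_le_four (hG : G.IsRegularOfDegree 5) (h : G.Adj v w) :
    G.codegree v w ≤ 4 :=
  (Finset.card_le_card inter_neighborFinset_subset_erase).trans_eq
    (h.card_erase_neighborFinset hG)

lemma Adj.inter_eq_erase_of_codegree_eq_four (hG : G.IsRegularOfDegree 5) (h : G.Adj v w)
    (h4 : G.codegree v w = 4) :
    G.neighborFinset v ∩ G.neighborFinset w = (G.neighborFinset v).erase w :=
  Finset.eq_of_subset_of_card_le inter_neighborFinset_subset_erase
    ((h.card_erase_neighborFinset hG).trans h4.symm).le

/-- Adjacent vertices with four common neighbours are closed twins. -/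
lemma Adj.adj_of_codegree_eq_four (hG : G.IsRegularOfDegree 5) (h : G.Adj v w)
    (h4 : G.codegree v w = 4) {x : V} (hx : G.Adj v x) (hxw : x ≠ w) : G.Adj w x := by
  have hmem : x ∈ (G.neighborFinset v).erase w := by simp [hx, hxw]
  rw [← h.inter_eq_erase_of_codegree_eq_four hG h4] at hmem
  simpa using (Finset.mem_inter.1 hmem).2

lemma Adj.codegree_ne_four (hG : G.IsRegularOfDegree 5)
    (hsum : ∀ v, ∑ u ∈ G.neighborFinset v, G.codegree v u = 14) (huv : G.Adj u v) :
    G.codegree u v ≠ 4 := by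
  intro h4
  have h4' : G.codegree v u = 4 := by rwa [codegree_comm]
  obtain ⟨w, hw, hwle⟩ : ∃ w ∈ (G.neighborFinset u).erase v, G.codegree u w ≤ 2 := by
    by_contra! hcon
    have h1 := Finset.card_nsmul_le_sum _ (fun x => G.codegree u x) 3 fun x hx => Nat.succ_le_of_lt (hcon x hx)
    have h2 := huv.codegree_add_sum_erase
    rw [huv.card_erase_neighborFinset hG, smul_eq_mul] at h1
    have := hsum u
    omega
  simp only [Finset.mem_erase, mem_neighborFinset] at hw
  obtain ⟨hwv, huw⟩ := hw
  have hvw : G.Adj v w := huv.adj_of_codegree_eq_four hG h4 huw hwv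
  set R := ((G.neighborFinset w).erase u).erase v with hR
  have hvmem : v ∈ (G.neighborFinset w).erase u := by simp [huv.ne', hvw.symm]
  have hRcard : R.card = 3 := by
    rw [hR, Finset.card_erase_of_mem hvmem, huw.symm.card_erase_neighborFinset hG]
  have hwv_eq : G.codegree w v ≤ 2 := by
    refine le_trans ?_ hwle
    rw [codegree_comm, codegree, codegree]
    -- exchanging `u` and `v` maps the common neighbours of `v, w` to those of `u, w`
    refine Finset.card_le_card_of_injOn (Equiv.swap u v) ?_ (Equiv.injective _).injOn
    intro x hx
    simp only [Finset.coe_inter, Set.mem_inter_iff, Finset.mem_coe, mem_neighborFinset] at hx ⊢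
    by_cases hxu : x = u
    · subst hxu
      simp [huv, hvw.symm]
    · have hxv : x ≠ v := hx.1.ne'
      rw [Equiv.swap_apply_of_ne_of_ne hxu hxv]
      exact ⟨huv.symm.adj_of_codegree_eq_four hG h4' hx.1 hxu, hx.2⟩
  have hbound : ∀ z ∈ R, G.codegree w z ≤ 2 + if G.Adj u z then 2 else 0 := by
    intro z hz
    simp only [hR, Finset.mem_erase, mem_neighborFinset] at hz
    obtain ⟨hzv, hzu, hwz⟩ := hz
    split_ifs with huz
    · exact hwz.codegree_le_four hG
    · have hvz : ¬ G.Adj v z := fun h => huz (huv.symm.adj_of_codegree_eq_four hG h4' h hzu)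
      have hsub : G.neighborFinset w ∩ G.neighborFinset z ⊆ R.erase z := by
        intro x hx
        simp only [hR, Finset.mem_inter, mem_neighborFinset, Finset.mem_erase] at hx ⊢
        refine ⟨hx.2.ne', ?_, ?_, hx.1⟩
        · rintro rfl; exact hvz hx.2.symm
        · rintro rfl; exact huz hx.2.symm
      have := Finset.card_le_card hsub
      rw [Finset.card_erase_of_mem (by simp [hR, hzv, hzu, hwz]), hRcard] at this
      exact this
  have hRu : (R.filter fun z => G.Adj u z).card ≤ 1 := by
    have hsub : insert v (R.filter fun z => G.Adj u z) ⊆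
        G.neighborFinset u ∩ G.neighborFinset w := by
      intro x hx
      simp only [hR, Finset.mem_insert, Finset.mem_filter, Finset.mem_erase,
        mem_neighborFinset, Finset.mem_inter] at hx ⊢
      rcases hx with rfl | hx
      · exact ⟨huv, hvw.symm⟩
      · exact ⟨hx.2, hx.1.2.2⟩
    have := (Finset.card_le_card hsub).trans hwle
    rw [Finset.card_insert_of_notMem (by simp [hR])] at this
    omega
  have hRsum := Finset.sum_le_sum hbound
  rw [Finset.sum_add_distrib, ← Finset.sum_filter, Finset.sum_const, Finset.sum_const,
    hRcard, smul_eq_mul, smul_eq_mul] at hRsum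
  have h1 := huw.symm.codegree_add_sum_erase
  have h2 := Finset.add_sum_erase _ (fun x => G.codegree w x) hvmem
  rw [← hR] at h2
  have h3 := hsum w
  rw [codegree_comm] at hwle
  omega

lemma exists_codegree_eq_two (hG : G.IsRegularOfDegree 5)
    (hsum : ∀ v, ∑ u ∈ G.neighborFinset v, G.codegree v u = 14) (v : V) :
    ∃ q, G.Adj v q ∧ G.codegree v q ≤ 2 := by
  by_contra! hcon
  have h := Finset.card_nsmul_le_sum (G.neighborFinset v) (fun x => G.codegree v x) 3
    fun x hx => Nat.succ_le_of_lt (hcon x (by simpa using hx))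
  rw [card_neighborFinset_eq_degree, hG v, hsum v] at h
  norm_num at h

/-- If `v q` is an edge with at most two common neighbours, it has exactly two, and every other
edge at `v` has three. -/
lemma codegree_eq_of_codegree_le_two (hG : G.IsRegularOfDegree 5)
    (hsum : ∀ v, ∑ u ∈ G.neighborFinset v, G.codegree v u = 14) {q : V} (hq : G.Adj v q)
    (hle : G.codegree v q ≤ 2) :
    G.codegree v q = 2 ∧ ∀ p, G.Adj v p → p ≠ q → G.codegree v p = 3 := by
  have h3 : ∀ p, G.Adj v p → G.codegree v p ≤ 3 := fun p hp => by
    have := hp.codegree_le_four hG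
    have := hp.codegree_ne_four hG hsum
    omega
  have h1 := hq.codegree_add_sum_erase
  have hv := hsum v
  have hle3 : ∀ p ∈ (G.neighborFinset v).erase q, G.codegree v p ≤ 3 :=
    fun p hp => h3 p (by simpa using (Finset.mem_erase.1 hp).2)
  have hc : ∑ p ∈ (G.neighborFinset v).erase q, 3 = 12 := by
    rw [Finset.sum_const, hq.card_erase_neighborFinset hG, smul_eq_mul]
  have h2 := Finset.sum_le_sum hle3
  refine ⟨by omega, fun p hp hpq => ?_⟩
  exact (Finset.sum_eq_sum_iff_of_le hle3).1 (by omega) p (by simp [hp, hpq])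

/-- A common neighbour of `v` and `q` is adjacent to the neighbours of `v` not adjacent to `q`. -/
lemma adj_of_not_adj (hG : G.IsRegularOfDegree 5) {p q s : V} (hvp : G.Adj v p)
    (hvq : G.Adj v q) (hvs : G.Adj v s) (hpq : p ≠ q) (hqs : G.Adj q s) (hqp : ¬ G.Adj q p)
    (h3 : G.codegree v p = 3) : G.Adj s p := by
  by_contra hsp
  have hps : p ≠ s := by rintro rfl; exact hqp hqs
  have hsub : G.neighborFinset v ∩ G.neighborFinset p ⊆
      (((G.neighborFinset v).erase p).erase q).erase s := by
    intro x hx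
    simp only [Finset.mem_inter, mem_neighborFinset, Finset.mem_erase] at hx ⊢
    refine ⟨?_, ?_, hx.2.ne', hx.1⟩
    · rintro rfl; exact hsp hx.2.symm
    · rintro rfl; exact hqp hx.2.symm
  have := Finset.card_le_card hsub
  rw [Finset.card_erase_of_mem (by simp [hqs.ne', hps.symm, hvs]),
    Finset.card_erase_of_mem (by simp [hpq.symm, hvq]), hvp.card_erase_neighborFinset hG] at this
  rw [codegree] at h3
  omega

lemma card_neighborFinset_sdiff (hG : G.IsRegularOfDegree 5) {q : V} (hvq : G.Adj v q)
    (h2 : G.codegree v q = 2) :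
    (((G.neighborFinset v).erase q) \ G.neighborFinset q).card = 2 := by
  have h := Finset.card_sdiff_add_card_inter ((G.neighborFinset v).erase q) (G.neighborFinset q)
  rw [hvq.card_erase_neighborFinset hG] at h
  have heq : (G.neighborFinset v).erase q ∩ G.neighborFinset q =
      G.neighborFinset v ∩ G.neighborFinset q := by
    ext x
    simp only [Finset.mem_inter, Finset.mem_erase, mem_neighborFinset]
    exact ⟨fun h => ⟨h.1.2, h.2⟩, fun h => ⟨⟨h.2.ne', h.1⟩, h.2⟩⟩
  rw [codegree] at h2
  rw [heq] at h
  omega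

lemma not_sum_codegree_eq_fourteen [Nonempty V] (hG : G.IsRegularOfDegree 5) :
    ¬ ∀ v, ∑ u ∈ G.neighborFinset v, G.codegree v u = 14 := by
  intro hsum
  obtain ⟨v⟩ := ‹Nonempty V›
  obtain ⟨q, hvq, hle⟩ := exists_codegree_eq_two hG hsum v
  obtain ⟨h2, h3⟩ := codegree_eq_of_codegree_le_two hG hsum hvq hle
  obtain ⟨h2', h3'⟩ := codegree_eq_of_codegree_le_two hG hsum hvq.symm
    (by rwa [codegree_comm])
  obtain ⟨s, hs⟩ : (G.neighborFinset v ∩ G.neighborFinset q).Nonempty := by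
    rw [← Finset.card_pos, ← codegree, h2]; exact Nat.two_pos
  simp only [Finset.mem_inter, mem_neighborFinset] at hs
  obtain ⟨hvs, hqs⟩ := hs
  set A := ((G.neighborFinset v).erase q) \ G.neighborFinset q with hA
  set B := ((G.neighborFinset q).erase v) \ G.neighborFinset v with hB
  have hAB : Disjoint A B := by
    rw [Finset.disjoint_left]
    intro x hxA hxB
    simp only [hA, hB, Finset.mem_sdiff, Finset.mem_erase] at hxA hxB
    exact hxA.2 hxB.1.2
  have hsub : insert v (insert q (A ∪ B)) ⊆ G.neighborFinset s := by
    intro x hx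
    simp only [hA, hB, Finset.mem_insert, Finset.mem_union, Finset.mem_sdiff, Finset.mem_erase,
      mem_neighborFinset] at hx ⊢
    rcases hx with rfl | rfl | ⟨⟨hxq, hvx⟩, hqx⟩ | ⟨⟨hxv, hqx⟩, hvx⟩
    · exact hvs.symm
    · exact hqs.symm
    · exact adj_of_not_adj hG hvx hvq hvs hxq hqs hqx (h3 x hvx hxq)
    · exact adj_of_not_adj hG hqx hvq.symm hqs hxv hvs hvx (h3' x hqx hxv)
  have hcard := Finset.card_le_card hsub
  rw [Finset.card_insert_of_notMem (by simp [hA, hB, hvq.ne]),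
    Finset.card_insert_of_notMem (by simp [hA, hB]), Finset.card_union_of_disjoint hAB,
    card_neighborFinset_sdiff hG hvq h2, card_neighborFinset_sdiff hG hvq.symm h2',
    card_neighborFinset_eq_degree, hG s] at hcard
  omega

end SimpleGraph

/-- No (5,7)-constant graph exists: there is no finite simple graph on a
nonempty vertex set that is 5-regular and in which the subgraph induced by
the open neighbourhood of every vertex has exactly 7 edges. -/
theorem no_five_seven_constant_graph :
    ¬ ∃ (V : Type) (_ : Fintype V) (_ : Nonempty V) (G : SimpleGraph V),
      (∀ v : V, Nat.card (G.neighborSet v) = 5) ∧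
      (∀ v : V, nbhdEdgeCount G v = 7) := by
  classical
  rintro ⟨V, _, _, G, hdeg, hedge⟩
  refine SimpleGraph.not_sum_codegree_eq_fourteen (G := G) (fun v => ?_) fun v => ?_
  · rw [← hdeg v, Nat.card_eq_fintype_card, SimpleGraph.card_neighborSet_eq_degree]
  · rw [G.sum_codegree_eq_two_mul_nbhdEdgeCount, hedge v]
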